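/- Let ρ : ℝ² → Matrix (Fin d) (Fin d) ℂ be a two-parameter family of density matrices in spectral form ρ(x,y) = Σ_{n=1}^{r} q_n |φ_n(x,y)⟩⟨φ_n(x,y)| that is quasi-pure in both parameters at a point (x₀,y₀), and let L_x = 2 Σ_n ( |𝒟_x φ_n⟩⟨φ_n| + |φ_n⟩⟨𝒟_x φ_n| ) and L_y = 2 Σ_n ( |𝒟_y φ_n⟩⟨φ_n| + |φ_n⟩⟨𝒟_y φ_n| ) be the corresponding SLDs at (x₀,y₀). Then the partial commutativity condition ⟨φ_k, [L_x, L_y] φ_l⟩ = 0 for all k, l = 1,…,r holds if and only if ⟨𝒟_x φ_k, 𝒟_y φ_l⟩ = ⟨𝒟_y φ_k, 𝒟_x φ_l⟩ for all k, l = 1,…,r. -/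

import Mathlib

open Matrix
open scoped Classical

/-- The rank-one matrix `|v⟩⟨w|`, sending `u` to `⟨w, u⟩ v`. -/
noncomputable def ketbra {n : Type*} (v w : n → ℂ) : Matrix n n ℂ :=
  Matrix.vecMulVec v (star w)

theorem ketbra_mulVec {n : Type*} [Fintype n] (v w u : n → ℂ) :
    ketbra v w *ᵥ u = (star w ⬝ᵥ u) • v := by
  rw [ketbra, vecMulVec_mulVec]
  ext i
  simp [mul_comm]

theorem vecMul_ketbra {n : Type*} [Fintype n] (u v w : n → ℂ) :
    u ᵥ* ketbra v w = (u ⬝ᵥ v) • star w := by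
  rw [ketbra, vecMul_vecMulVec]

theorem sum_smul_ketbra_mulVec {ι n : Type*} [Fintype ι] [DecidableEq ι] [Fintype n]
    (p : ι → ℂ) (v : ι → n → ℂ)
    (hv : ∀ i j, star (v i) ⬝ᵥ v j = if i = j then 1 else 0) (l : ι) :
    (∑ i, p i • ketbra (v i) (v i)) *ᵥ v l = p l • v l := by
  simp [sum_mulVec, smul_mulVec, ketbra_mulVec, hv, ite_smul]

theorem vecMul_sum_smul_ketbra {ι n : Type*} [Fintype ι] [DecidableEq ι] [Fintype n]
    (p : ι → ℂ) (v : ι → n → ℂ)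
    (hv : ∀ i j, star (v i) ⬝ᵥ v j = if i = j then 1 else 0) (k : ι) :
    star (v k) ᵥ* (∑ i, p i • ketbra (v i) (v i)) = p k • star (v k) := by
  simp [vecMul_sum, vecMul_smul, vecMul_ketbra, hv, ite_smul]

/-- Quasi-purity makes the covariant derivatives orthogonal to the support of the state. -/
theorem dotProduct_covariantDerivative_eq_zero {ι n : Type*} [Fintype ι] [DecidableEq ι] [Fintype n]
    (ρ : ℝ → Matrix n n ℂ) (q : ι → ℝ → ℝ) (φ : ι → ℝ → n → ℂ)
    (hortho : ∀ t i j, star (φ i t) ⬝ᵥ φ j t = if i = j then 1 else 0)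
    (hspec : ∀ t, ρ t = ∑ i, (q i t : ℂ) • ketbra (φ i t) (φ i t))
    (t₀ : ℝ) (q' : ι → ℝ) (hq : ∀ i, HasDerivAt (q i) (q' i) t₀)
    (φ' : ι → n → ℂ) (hφ : ∀ i a, HasDerivAt (fun t => φ i t a) (φ' i a) t₀)
    (ρ' : Matrix n n ℂ) (hρ : ∀ a b, HasDerivAt (fun t => ρ t a b) (ρ' a b) t₀)
    (hqp : ∀ k l, star (φ k t₀) ⬝ᵥ (ρ' *ᵥ φ l t₀) = 0)
    (D : ι → n → ℂ)
    (hD : ∀ i, D i = φ' i - ∑ m ∈ Finset.univ.filter (fun m => q m t₀ = q i t₀),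
      (star (φ m t₀) ⬝ᵥ φ' i) • φ m t₀) (k l : ι) :
    star (φ k t₀) ⬝ᵥ D l = 0 := by
  have deriv_left : HasDerivAt (fun t => star (φ k t₀) ⬝ᵥ (ρ t *ᵥ φ l t))
      (star (φ k t₀) ⬝ᵥ (ρ' *ᵥ φ l t₀ + ρ t₀ *ᵥ φ' l)) t₀ := by
    simp only [dotProduct, mulVec, Pi.add_apply, ← Finset.sum_add_distrib]
    exact HasDerivAt.fun_sum fun a _ =>
      (HasDerivAt.fun_sum fun b _ => (hρ a b).mul (hφ l b)).const_mul _
  have deriv_right : HasDerivAt (fun t => (q l t : ℂ) * (star (φ k t₀) ⬝ᵥ φ l t))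
      ((q' l : ℂ) * (star (φ k t₀) ⬝ᵥ φ l t₀) + q l t₀ * (star (φ k t₀) ⬝ᵥ φ' l)) t₀ := by
    refine (hq l).ofReal_comp.mul ?_
    exact HasDerivAt.fun_sum fun a _ => (hφ l a).const_mul _
  have eigen (t : ℝ) : ρ t *ᵥ φ l t = (q l t : ℂ) • φ l t := by
    rw [hspec, sum_smul_ketbra_mulVec _ (fun i => φ i t) (hortho t)]
  simp only [eigen, dotProduct_smul, smul_eq_mul] at deriv_left
  have key := deriv_left.unique deriv_right
  rw [dotProduct_add, hqp, zero_add, dotProduct_mulVec, hspec t₀,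
    vecMul_sum_smul_ketbra _ (fun i => φ i t₀) (hortho t₀), smul_dotProduct, hortho,
    smul_eq_mul] at key
  have proj : star (φ k t₀) ⬝ᵥ D l = star (φ k t₀) ⬝ᵥ φ' l -
      if q k t₀ = q l t₀ then star (φ k t₀) ⬝ᵥ φ' l else 0 := by
    simp [hD, dotProduct_sub, dotProduct_sum, dotProduct_smul, hortho]
  rw [proj]
  split_ifs with h
  · exact sub_self _
  · have hkl : k ≠ l := fun e => h (by rw [e])
    rw [if_neg hkl, mul_zero, zero_add] at key
    rw [sub_zero]
    exact (mul_eq_mul_right_iff.mp key).resolve_left (mod_cast h)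

theorem sum_ketbra_add_ketbra_mulVec {ι n : Type*} [Fintype ι] [DecidableEq ι] [Fintype n]
    (v D : ι → n → ℂ)
    (hv : ∀ i j, star (v i) ⬝ᵥ v j = if i = j then 1 else 0)
    (hD : ∀ k l, star (v k) ⬝ᵥ D l = 0) (l : ι) :
    ((2 : ℂ) • ∑ i, (ketbra (D i) (v i) + ketbra (v i) (D i))) *ᵥ v l = (2 : ℂ) • D l := by
  have hD' (i : ι) : star (D i) ⬝ᵥ v l = 0 := by
    rw [← star_star (v l), star_dotProduct_star, dotProduct_comm]
    simpa [dotProduct_comm] using hD l i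
  simp [sum_mulVec, smul_mulVec, add_mulVec, ketbra_mulVec, hv, hD', ite_smul]

theorem vecMul_sum_ketbra_add_ketbra {ι n : Type*} [Fintype ι] [DecidableEq ι] [Fintype n]
    (v D : ι → n → ℂ)
    (hv : ∀ i j, star (v i) ⬝ᵥ v j = if i = j then 1 else 0)
    (hD : ∀ k l, star (v k) ⬝ᵥ D l = 0) (k : ι) :
    star (v k) ᵥ* ((2 : ℂ) • ∑ i, (ketbra (D i) (v i) + ketbra (v i) (D i))) =
      (2 : ℂ) • star (D k) := by
  simp [vecMul_sum, vecMul_smul, vecMul_add, vecMul_ketbra, hv, hD, ite_smul]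

/-- For a two-parameter family of density matrices
`ρ(x,y) = ∑ₙ qₙ(x,y)|φₙ(x,y)⟩⟨φₙ(x,y)|` that is quasi-pure in both parameters at `(x₀,y₀)`,
with SLDs `L_x = 2∑ₙ(|𝒟ₓφₙ⟩⟨φₙ| + |φₙ⟩⟨𝒟ₓφₙ|)` and `L_y = 2∑ₙ(|𝒟_yφₙ⟩⟨φₙ| + |φₙ⟩⟨𝒟_yφₙ|)`,
the partial commutativity condition `⟨φₖ, [L_x, L_y] φₗ⟩ = 0` for all `k, l` holds if and
only if `⟨𝒟ₓφₖ, 𝒟_yφₗ⟩ = ⟨𝒟_yφₖ, 𝒟ₓφₗ⟩` for all `k, l`. -/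
theorem partial_commutativity_iff_covariant_derivative_symmetry
    {d r : ℕ}
    (ρ : ℝ → ℝ → Matrix (Fin d) (Fin d) ℂ)
    (q : Fin r → ℝ → ℝ → ℝ) (φ : Fin r → ℝ → ℝ → Fin d → ℂ)
    (hortho : ∀ x y m n, star (φ m x y) ⬝ᵥ φ n x y = if m = n then 1 else 0)
    (hqpos : ∀ x y n, 0 < q n x y)
    (hqsum : ∀ x y, ∑ n, q n x y = 1)
    (hspec : ∀ x y, ρ x y = ∑ n, (q n x y : ℂ) • ketbra (φ n x y) (φ n x y))
    (x₀ y₀ : ℝ)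
    (qx' qy' : Fin r → ℝ)
    (hqx' : ∀ n, HasDerivAt (fun x => q n x y₀) (qx' n) x₀)
    (hqy' : ∀ n, HasDerivAt (fun y => q n x₀ y) (qy' n) y₀)
    (φx' φy' : Fin r → Fin d → ℂ)
    (hφx' : ∀ n i, HasDerivAt (fun x => φ n x y₀ i) (φx' n i) x₀)
    (hφy' : ∀ n i, HasDerivAt (fun y => φ n x₀ y i) (φy' n i) y₀)
    (ρx' ρy' : Matrix (Fin d) (Fin d) ℂ)
    (hρx' : ∀ i j, HasDerivAt (fun x => ρ x y₀ i j) (ρx' i j) x₀)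
    (hρy' : ∀ i j, HasDerivAt (fun y => ρ x₀ y i j) (ρy' i j) y₀)
    (hqpx : ∀ k l, star (φ k x₀ y₀) ⬝ᵥ (ρx' *ᵥ φ l x₀ y₀) = 0)
    (hqpy : ∀ k l, star (φ k x₀ y₀) ⬝ᵥ (ρy' *ᵥ φ l x₀ y₀) = 0)
    (Dx Dy : Fin r → Fin d → ℂ)
    (hDx : ∀ n, Dx n = φx' n - ∑ m ∈ Finset.univ.filter (fun m => q m x₀ y₀ = q n x₀ y₀),
        (star (φ m x₀ y₀) ⬝ᵥ φx' n) • φ m x₀ y₀)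
    (hDy : ∀ n, Dy n = φy' n - ∑ m ∈ Finset.univ.filter (fun m => q m x₀ y₀ = q n x₀ y₀),
        (star (φ m x₀ y₀) ⬝ᵥ φy' n) • φ m x₀ y₀)
    (Lx Ly : Matrix (Fin d) (Fin d) ℂ)
    (hLx : Lx = (2 : ℂ) • ∑ n, (ketbra (Dx n) (φ n x₀ y₀) + ketbra (φ n x₀ y₀) (Dx n)))
    (hLy : Ly = (2 : ℂ) • ∑ n, (ketbra (Dy n) (φ n x₀ y₀) + ketbra (φ n x₀ y₀) (Dy n))) :
    (∀ k l, star (φ k x₀ y₀) ⬝ᵥ ((Lx * Ly - Ly * Lx) *ᵥ φ l x₀ y₀) = 0) ↔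
      (∀ k l, star (Dx k) ⬝ᵥ Dy l = star (Dy k) ⬝ᵥ Dx l) := by
  have hv := hortho x₀ y₀
  have orthx := dotProduct_covariantDerivative_eq_zero (fun x => ρ x y₀) (fun n x => q n x y₀)
    (fun n x => φ n x y₀) (fun x => hortho x y₀) (fun x => hspec x y₀) x₀ qx' hqx' φx' hφx'
    ρx' hρx' hqpx Dx hDx
  have orthy := dotProduct_covariantDerivative_eq_zero (fun y => ρ x₀ y) (fun n y => q n x₀ y)
    (fun n y => φ n x₀ y) (hortho x₀) (hspec x₀) y₀ qy' hqy' φy' hφy' ρy' hρy' hqpy Dy hDy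
  have commutator (k l : Fin r) :
      star (φ k x₀ y₀) ⬝ᵥ ((Lx * Ly - Ly * Lx) *ᵥ φ l x₀ y₀) =
        4 * (star (Dx k) ⬝ᵥ Dy l - star (Dy k) ⬝ᵥ Dx l) := by
    rw [sub_mulVec, ← mulVec_mulVec, ← mulVec_mulVec, dotProduct_sub,
      dotProduct_mulVec _ Lx (Ly *ᵥ _),
      dotProduct_mulVec _ Ly (Lx *ᵥ _), hLx, hLy,
      sum_ketbra_add_ketbra_mulVec (fun n => φ n x₀ y₀) Dx hv orthx,
      sum_ketbra_add_ketbra_mulVec (fun n => φ n x₀ y₀) Dy hv orthy,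
      vecMul_sum_ketbra_add_ketbra (fun n => φ n x₀ y₀) Dx hv orthx,
      vecMul_sum_ketbra_add_ketbra (fun n => φ n x₀ y₀) Dy hv orthy]
    simp only [smul_dotProduct, dotProduct_smul, smul_eq_mul]
    ring
  simp [commutator, sub_eq_zero]
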